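/- arXiv:1212.0441 — 4 statements merged into one kernel-verified Lean document; each statement's English description precedes it below -/
import Mathlib

section
/- The series ∑_{n=1}^∞ si(2nπ)/(nπ) converges and ∑_{n=1}^∞ si(2nπ)/(nπ) = (1/2)·log(2π) − 1. -/
open Real Filter MeasureTheory Topology

/-- The sine integral `si(x) = -∫_x^∞ (sin t)/t dt`, as the limit of
`-∫_x^b (sin t)/t dt` as `b → ∞`. -/
noncomputable def si (x : ℝ) : ℝ :=
  - limUnder atTop (fun b : ℝ => ∫ t in x..b, Real.sin t / t)


/-- The auxiliary kernel `(1 - cos t) / t ^ 2`. -/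
noncomputable def siKer (t : ℝ) : ℝ := (1 - Real.cos t) / t ^ 2

lemma siKer_norm_le (t : ℝ) : ‖siKer t‖ ≤ 2 * (t ^ 2)⁻¹ := by
  unfold siKer
  rw [Real.norm_eq_abs, abs_div, abs_of_nonneg (by positivity : (0:ℝ) ≤ t ^ 2), div_eq_mul_inv]
  gcongr
  rw [abs_le]
  constructor <;> linarith [Real.cos_le_one t, Real.neg_one_le_cos t]

lemma siKer_measurable : Measurable siKer := by
  unfold siKer
  fun_prop

lemma inv_sq_integrableOn {x : ℝ} (hx : 0 < x) :
    IntegrableOn (fun t : ℝ => (t ^ 2)⁻¹) (Set.Ioi x) := by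
  have h := integrableOn_Ioi_rpow_of_lt (a := -2) (by norm_num) hx
  refine h.congr_fun (fun t ht => ?_) measurableSet_Ioi
  have ht0 : 0 < t := hx.trans ht
  simp only
  rw [Real.rpow_neg ht0.le]
  norm_num

lemma siKer_integrableOn {x : ℝ} (hx : 0 < x) : IntegrableOn siKer (Set.Ioi x) := by
  refine Integrable.mono' ((inv_sq_integrableOn hx).const_mul 2)
    siKer_measurable.aestronglyMeasurable ?_
  exact Filter.Eventually.of_forall siKer_norm_le

lemma si_parts {x b : ℝ} (hx : 0 < x) (hb : x ≤ b) :
    ∫ t in x..b, Real.sin t / t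
      = (1 - Real.cos b) / b - (1 - Real.cos x) / x + ∫ t in x..b, siKer t := by
  have hpos : ∀ t ∈ Set.uIcc x b, t ≠ 0 := by
    intro t ht
    rw [Set.uIcc_of_le hb] at ht
    exact (hx.trans_le ht.1).ne'
  have h1 : IntervalIntegrable (fun t : ℝ => Real.sin t / t) volume x b :=
    (ContinuousOn.div (by fun_prop) (by fun_prop) hpos).intervalIntegrable
  have h2 : IntervalIntegrable siKer volume x b := by
    refine ContinuousOn.intervalIntegrable ?_
    unfold siKer
    exact ContinuousOn.div (by fun_prop) (by fun_prop) (fun t ht => pow_ne_zero 2 (hpos t ht))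
  have h3 : ∫ t in x..b, (Real.sin t / t - siKer t)
      = (1 - Real.cos b) / b - (1 - Real.cos x) / x := by
    refine intervalIntegral.integral_eq_sub_of_hasDerivAt
      (f := fun t : ℝ => (1 - Real.cos t) / t) (fun t ht => ?_) (h1.sub h2)
    have ht0 := hpos t ht
    refine (((Real.hasDerivAt_cos t).const_sub 1).div (hasDerivAt_id t) ht0).congr_deriv ?_
    unfold siKer
    simp only [id]
    field_simp
    try ring
  rw [intervalIntegral.integral_sub h1 h2] at h3
  linarith

lemma si_tendsto {x : ℝ} (hx : 0 < x) :
    Tendsto (fun b : ℝ => ∫ t in x..b, Real.sin t / t) atTop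
      (𝓝 (0 - (1 - Real.cos x) / x + ∫ t in Set.Ioi x, siKer t)) := by
  have h1 : Tendsto (fun b : ℝ => (1 - Real.cos b) / b) atTop (𝓝 0) := by
    have h0 : Tendsto (fun b : ℝ => 2 * b⁻¹) atTop (𝓝 0) := by
      simpa using (tendsto_inv_atTop_zero (𝕜 := ℝ)).const_mul 2
    refine squeeze_zero' ?_ ?_ h0
    · filter_upwards [eventually_gt_atTop 0] with b hb
      have := Real.cos_le_one b
      exact div_nonneg (by linarith) hb.le
    · filter_upwards [eventually_gt_atTop 0] with b hb
      rw [div_eq_mul_inv]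
      gcongr
      linarith [Real.neg_one_le_cos b]
  have h2 := intervalIntegral_tendsto_integral_Ioi x (siKer_integrableOn hx) tendsto_id
  refine ((h1.sub_const ((1 - Real.cos x) / x)).add h2).congr' ?_
  filter_upwards [eventually_ge_atTop x] with b hb
  rw [si_parts hx hb]
  rfl

lemma si_eq {x : ℝ} (hx : 0 < x) :
    - si x = 0 - (1 - Real.cos x) / x + ∫ t in Set.Ioi x, siKer t := by
  unfold si
  rw [neg_neg]
  exact (si_tendsto hx).limUnder_eq

lemma si_term (n : ℕ) :
    si (2 * ((n : ℝ) + 1) * π) / (((n : ℝ) + 1) * π)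
      = ∫ u in Set.Ioi (1:ℝ), -2 * siKer (2 * ((n : ℝ) + 1) * π * u) := by
  have hn : (0:ℝ) < (n : ℝ) + 1 := by positivity
  have hb : 0 < 2 * ((n : ℝ) + 1) * π := by positivity
  have h := si_eq hb
  have hc : Real.cos (2 * ((n : ℝ) + 1) * π) = 1 := by
    have := Real.cos_nat_mul_two_pi (n + 1)
    push_cast at this
    rw [show 2 * ((n : ℝ) + 1) * π = ((n : ℝ) + 1) * (2 * π) by ring]
    exact this
  rw [hc] at h
  have hs := integral_comp_mul_left_Ioi siKer 1 hb
  rw [integral_const_mul, hs, mul_one, smul_eq_mul]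
  have h' : si (2 * ((n : ℝ) + 1) * π)
      = -∫ t in Set.Ioi (2 * ((n : ℝ) + 1) * π), siKer t := by
    simp at h
    linarith
  rw [h']
  have := Real.pi_pos.ne'
  field_simp

/-- The limit function. -/
noncomputable def siLim (u : ℝ) : ℝ := -(Int.fract u * (1 - Int.fract u)) / (2 * u ^ 2)

lemma bern_two (x : ℝ) :
    (Polynomial.map (algebraMap ℚ ℝ) (Polynomial.bernoulli 2)).eval x = x ^ 2 - x + 1 / 6 := by
  rw [← bernoulliFun]
  simp [bernoulliFun, Polynomial.bernoulli, Finset.sum_range_succ, bernoulli_two]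
  try ring

lemma cos_sum {x : ℝ} (hx : x ∈ Set.Icc (0:ℝ) 1) :
    HasSum (fun n : ℕ => 1 / (n : ℝ) ^ 2 * Real.cos (2 * π * n * x))
      (π ^ 2 * (x ^ 2 - x + 1 / 6)) := by
  have h := hasSum_one_div_nat_pow_mul_cos (k := 1) one_ne_zero hx
  simp only [mul_one, bern_two] at h
  convert h using 1
  rw [show ((Nat.factorial 2 : ℕ) : ℝ) = 2 by norm_num [Nat.factorial]]
  ring

lemma lim_sum {u : ℝ} (hu : 1 < u) :
    HasSum (fun n : ℕ => -2 * siKer (2 * ((n : ℝ) + 1) * π * u)) (siLim u) := by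
  have hu0 : u ≠ 0 := by linarith
  have hpi := Real.pi_pos.ne'
  have h0 := cos_sum (x := 0) (by simp)
  have h1 := cos_sum (x := Int.fract u) ⟨Int.fract_nonneg u, (Int.fract_lt_one u).le⟩
  have h2 := (h0.sub h1).mul_left (-(2 * π ^ 2 * u ^ 2)⁻¹)
  rw [← hasSum_nat_add_iff' 1] at h2
  have e1 : (fun n : ℕ => -2 * siKer (2 * ((n : ℝ) + 1) * π * u)) = fun n : ℕ =>
      -(2 * π ^ 2 * u ^ 2)⁻¹ * (1 / ((n + 1 : ℕ) : ℝ) ^ 2 * Real.cos (2 * π * ((n + 1 : ℕ) : ℝ) * 0)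
        - 1 / ((n + 1 : ℕ) : ℝ) ^ 2 * Real.cos (2 * π * ((n + 1 : ℕ) : ℝ) * Int.fract u)) := by
    funext n
    have hc : Real.cos (2 * ((n : ℝ) + 1) * π * u)
        = Real.cos (2 * π * (n + 1) * Int.fract u) := by
      have e : 2 * ((n : ℝ) + 1) * π * u
          = 2 * π * (n + 1) * Int.fract u + (((n + 1) * ⌊u⌋ : ℤ) : ℝ) * (2 * π) := by
        have := Int.fract_add_floor u
        push_cast
        linear_combination (-(2 * π * ((n:ℝ) + 1))) * this
      rw [e, Real.cos_add_int_mul_two_pi]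
    unfold siKer
    rw [hc]
    have hn : (n : ℝ) + 1 ≠ 0 := by positivity
    push_cast
    simp only [mul_zero, Real.cos_zero]
    field_simp
    try ring
  have e2 : siLim u = -(2 * π ^ 2 * u ^ 2)⁻¹ * (π ^ 2 * (0 ^ 2 - 0 + 1 / 6)
      - π ^ 2 * (Int.fract u ^ 2 - Int.fract u + 1 / 6)) -
      ∑ i ∈ Finset.range 1, -(2 * π ^ 2 * u ^ 2)⁻¹ * (1 / (i : ℝ) ^ 2 * Real.cos (2 * π * i * 0)
        - 1 / (i : ℝ) ^ 2 * Real.cos (2 * π * i * Int.fract u)) := by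
    simp [siLim]
    field_simp
    try ring
  rw [e1, e2]
  exact h2

lemma main_hasSum :
    HasSum (fun n : ℕ => si (2 * ((n : ℝ) + 1) * π) / (((n : ℝ) + 1) * π))
      (∫ u in Set.Ioi (1:ℝ), siLim u) := by
  simp only [si_term]
  have hsum : Summable (fun n : ℕ => 1 / ((n : ℝ) + 1) ^ 2) := by
    have := (summable_nat_add_iff 1).2 (Real.summable_one_div_nat_pow.2 (one_lt_two))
    simpa using this
  refine hasSum_integral_of_dominated_convergence
    (fun n u => 1 / ((n : ℝ) + 1) ^ 2 * (u ^ 2)⁻¹) ?_ ?_ ?_ ?_ ?_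
  · intro n
    exact ((siKer_measurable.comp (measurable_const_mul _)).const_mul _).aestronglyMeasurable
  · intro n
    refine Filter.Eventually.of_forall (fun u => ?_)
    rw [norm_mul]
    have h1 := siKer_norm_le (2 * ((n : ℝ) + 1) * π * u)
    have h2 : (2 * ((n : ℝ) + 1) * π * u ) ^ 2 = (2 * π) ^ 2 * (((n:ℝ) + 1) ^ 2 * u ^ 2) := by ring
    rw [h2, mul_inv, mul_inv] at h1
    have h3 : ((2 * π) ^ 2)⁻¹ ≤ (4:ℝ)⁻¹ := by
      apply inv_anti₀ (by norm_num)
      nlinarith [Real.pi_gt_three]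
    have h4 : ((2 * π) ^ 2)⁻¹ * ((((n:ℝ) + 1) ^ 2)⁻¹ * (u ^ 2)⁻¹)
        ≤ (4:ℝ)⁻¹ * ((((n:ℝ) + 1) ^ 2)⁻¹ * (u ^ 2)⁻¹) := by gcongr
    rw [one_div]
    norm_num at h1 h4 ⊢
    linarith
  · exact Filter.Eventually.of_forall (fun u => hsum.mul_right _)
  · simp only [tsum_mul_right]
    exact (inv_sq_integrableOn one_pos).const_mul _
  · filter_upwards [ae_restrict_mem measurableSet_Ioi] with u hu
    exact lim_sum hu

lemma siLim_integrableOn : IntegrableOn siLim (Set.Ioi (1:ℝ)) := by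
  refine Integrable.mono' (inv_sq_integrableOn one_pos) ?_ ?_
  · unfold siLim
    exact Measurable.aestronglyMeasurable (by fun_prop)
  · refine Filter.Eventually.of_forall (fun u => ?_)
    have h0 := Int.fract_nonneg u
    have h1 := Int.fract_lt_one u
    unfold siLim
    rw [norm_div, norm_neg, Real.norm_of_nonneg (by nlinarith),
      Real.norm_of_nonneg (by positivity), div_eq_mul_inv, mul_inv]
    have h2 : 0 ≤ (u ^ 2)⁻¹ := by positivity
    have h3 : Int.fract u * (1 - Int.fract u) ≤ 1 := by nlinarith
    nlinarith [mul_le_mul_of_nonneg_right h3 h2]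

lemma siLim_piece (k : ℕ) :
    ∫ u in ((k + 1 : ℕ) : ℝ)..((k + 2 : ℕ) : ℝ), siLim u
      = Real.log (Stirling.stirlingSeq (k + 2)) - Real.log (Stirling.stirlingSeq (k + 1)) := by
  have hk : (0:ℝ) < (k:ℝ) + 1 := by positivity
  set a : ℝ := (k:ℝ) + 1 with ha
  have e1 : ((k + 1 : ℕ) : ℝ) = a := by push_cast; rfl
  have e2 : ((k + 2 : ℕ) : ℝ) = a + 1 := by push_cast; rw [ha]; ring
  have hle : a ≤ a + 1 := by linarith
  have hcongr : ∫ u in a..(a + 1), siLim u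
      = ∫ u in a..(a + 1), (1 / 2 - (2 * a + 1) / 2 * u⁻¹ + a * (a + 1) / 2 * (u ^ 2)⁻¹) := by
    rw [intervalIntegral.integral_of_le hle, intervalIntegral.integral_of_le hle,
      integral_Ioc_eq_integral_Ioo, integral_Ioc_eq_integral_Ioo]
    refine setIntegral_congr_fun measurableSet_Ioo (fun u hu => ?_)
    have hu0 : u ≠ 0 := (hk.trans hu.1).ne'
    have hfl : ⌊u⌋ = ((k + 1 : ℕ) : ℤ) := by
      rw [Int.floor_eq_iff]
      push_cast
      exact ⟨hu.1.le, hu.2⟩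
    have hfr : Int.fract u = u - a := by
      rw [← Int.self_sub_floor, hfl]
      push_cast
      rfl
    simp only [siLim, hfr]
    field_simp
    ring
  have hpos : ∀ t ∈ Set.uIcc a (a + 1), t ≠ 0 := by
    intro t ht
    rw [Set.uIcc_of_le hle] at ht
    exact (hk.trans_le ht.1).ne'
  have hint : ∫ u in a..(a + 1), (1 / 2 - (2 * a + 1) / 2 * u⁻¹ + a * (a + 1) / 2 * (u ^ 2)⁻¹)
      = (1 / 2 * (a + 1) - (2 * a + 1) / 2 * Real.log (a + 1) - a * (a + 1) / 2 * (a + 1)⁻¹)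
        - (1 / 2 * a - (2 * a + 1) / 2 * Real.log a - a * (a + 1) / 2 * a⁻¹) := by
    refine intervalIntegral.integral_eq_sub_of_hasDerivAt
      (f := fun u : ℝ => 1 / 2 * u - (2 * a + 1) / 2 * Real.log u - a * (a + 1) / 2 * u⁻¹)
      (fun t ht => ?_) ?_
    · have ht0 := hpos t ht
      refine ((((hasDerivAt_id t).const_mul (1 / 2)).sub
        ((Real.hasDerivAt_log ht0).const_mul ((2 * a + 1) / 2))).sub
        ((hasDerivAt_inv ht0).const_mul (a * (a + 1) / 2))).congr_deriv ?_
      ring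
    · refine ContinuousOn.intervalIntegrable ?_
      have c1 : ContinuousOn (fun u : ℝ => u⁻¹) (Set.uIcc a (a + 1)) :=
        continuousOn_id.inv₀ hpos
      have c2 : ContinuousOn (fun u : ℝ => (u ^ 2)⁻¹) (Set.uIcc a (a + 1)) :=
        (continuousOn_id.pow 2).inv₀ (fun t ht => pow_ne_zero 2 (hpos t ht))
      fun_prop
  rw [e1, e2, hcongr, hint, Stirling.log_stirlingSeq_formula, Stirling.log_stirlingSeq_formula,
    e1, e2]
  have hf : Real.log ((k + 2).factorial : ℝ)
      = Real.log (a + 1) + Real.log ((k + 1).factorial : ℝ) := by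
    rw [Nat.factorial_succ (k + 1), Nat.cast_mul, Real.log_mul (by positivity) (by positivity)]
    congr 2
  have ha1 : (0:ℝ) < a + 1 := by linarith
  rw [hf, Real.log_mul two_ne_zero ha1.ne', Real.log_mul two_ne_zero hk.ne',
    Real.log_div ha1.ne' (Real.exp_ne_zero _), Real.log_div hk.ne' (Real.exp_ne_zero _),
    Real.log_exp]
  field_simp
  ring

lemma siLim_integral :
    ∫ u in Set.Ioi (1:ℝ), siLim u = (1 / 2) * Real.log (2 * π) - 1 := by
  have hN : ∀ N : ℕ, ∫ u in (1:ℝ)..((N + 1 : ℕ) : ℝ), siLim u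
      = Real.log (Stirling.stirlingSeq (N + 1)) - Real.log (Stirling.stirlingSeq 1) := by
    intro N
    have hii : ∀ a b : ℝ, 1 ≤ a → a ≤ b → IntervalIntegrable siLim volume a b := by
      intro a b ha hab
      rw [intervalIntegrable_iff_integrableOn_Ioc_of_le hab]
      exact siLim_integrableOn.mono_set (fun t ht => lt_of_le_of_lt ha ht.1)
    induction N with
    | zero => simp
    | succ N ih =>
      rw [← intervalIntegral.integral_add_adjacent_intervals
        (hii 1 ((N + 1 : ℕ) : ℝ) le_rfl (by simp)) (hii _ _ (by simp) (by simp)), ih,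
        siLim_piece N]
      ring
  have h1 : Tendsto (fun N : ℕ => ∫ u in (1:ℝ)..((N + 1 : ℕ) : ℝ), siLim u) atTop
      (𝓝 (∫ u in Set.Ioi (1:ℝ), siLim u)) :=
    intervalIntegral_tendsto_integral_Ioi 1 siLim_integrableOn
      (tendsto_natCast_atTop_atTop.comp (tendsto_add_atTop_nat 1))
  have h2 : Tendsto (fun N : ℕ => Real.log (Stirling.stirlingSeq (N + 1))
      - Real.log (Stirling.stirlingSeq 1)) atTop
      (𝓝 (Real.log (√π) - Real.log (Stirling.stirlingSeq 1))) := by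
    refine Tendsto.sub_const ?_ _
    exact ((Stirling.tendsto_stirlingSeq_sqrt_pi.comp (tendsto_add_atTop_nat 1)).log
      (by positivity))
  simp only [hN] at h1
  rw [tendsto_nhds_unique h1 h2, Stirling.log_stirlingSeq_formula, Real.log_sqrt Real.pi_pos.le,
    Real.log_mul two_ne_zero Real.pi_pos.ne']
  simp
  ring

/-- `∑_{n=1}^∞ si(2nπ)/(nπ) = (1/2) log(2π) − 1`, the series converging
(and the improper integrals defining `si` converging). -/
theorem tsum_sineIntegral_two_pi_mul_div :
    (∀ x : ℝ, 0 < x →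
      Tendsto (fun b : ℝ => ∫ t in x..b, Real.sin t / t) atTop (𝓝 (-si x))) ∧
    HasSum (fun n : ℕ => si (2 * ((n : ℝ) + 1) * π) / (((n : ℝ) + 1) * π))
      ((1 / 2) * Real.log (2 * π) - 1) := by
  refine ⟨fun x hx => ?_, ?_⟩
  · rw [si_eq hx]
    exact si_tendsto hx
  · rw [← siLim_integral]
    exact main_hasSum
end

section
/- The series ∑_{n=1}^∞ Ci(2nπ)/n² converges and ∑_{n=1}^∞ Ci(2nπ)/n² = ζ(2)·(γ + log(2π)) − ζ'(2) − π²/2. -/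
open Real Filter MeasureTheory Topology

/-- The cosine integral `Ci(x) = -∫_x^∞ (cos t)/t dt`. -/
noncomputable def Ci (x : ℝ) : ℝ :=
  - limUnder atTop (fun b : ℝ => ∫ t in x..b, Real.cos t / t)


lemma hasSum_cast {M : Type} [AddCommMonoid M] [TopologicalSpace M] {f g : ℕ → M} {a b : M}
    (h : HasSum f a) (hfg : ∀ n, g n = f n) (hab : b = a) : HasSum g b := by
  rw [hab, funext hfg]
  exact h

lemma ii_of_bdd {f : ℝ → ℝ} (hf : Measurable f) {C : ℝ} (a b : ℝ)
    (h : ∀ t ∈ Set.uIoc a b, |f t| ≤ C) : IntervalIntegrable f volume a b := by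
  refine (intervalIntegrable_const (c := C) (μ := volume) (a := a) (b := b)).mono_fun
    hf.aestronglyMeasurable ?_
  refine (ae_restrict_iff' measurableSet_uIoc).2 (Eventually.of_forall fun t ht => ?_)
  exact (h t ht).trans (le_abs_self C)

lemma one_sub_cos_le (t : ℝ) : |1 - cos t| ≤ |t| := by
  have h1 : 0 ≤ 1 - cos t := by linarith [cos_le_one t]
  rw [abs_of_nonneg h1]
  rcases le_or_gt |t| 2 with h | h
  · nlinarith [one_sub_sq_div_two_le_cos (x := t), sq_abs t, abs_nonneg t]
  · linarith [neg_one_le_cos t]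

lemma cin_int (c a b : ℝ) : IntervalIntegrable (fun t => (1 - cos (c * t)) / t) volume a b := by
  refine ii_of_bdd (by fun_prop) (C := |c|) a b fun t _ => ?_
  rw [abs_div]
  rcases eq_or_ne t 0 with rfl | ht
  · simp
  · rw [div_le_iff₀ (abs_pos.2 ht), ← abs_mul]
    exact one_sub_cos_le _

lemma Ci_exists {x : ℝ} (hx : 0 < x) :
    Tendsto (fun b : ℝ => ∫ t in x..b, Real.cos t / t) atTop (𝓝 (-Ci x)) := by
  have hi : IntegrableOn (fun t : ℝ => sin t / t ^ 2) (Set.Ioi x) := by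
    have h := integrableOn_Ioi_rpow_of_lt (a := -2) (by norm_num) hx
    refine Integrable.mono' h (Measurable.aestronglyMeasurable (by fun_prop)) ?_
    refine (ae_restrict_iff' measurableSet_Ioi).2 (Eventually.of_forall fun t ht => ?_)
    have ht' : 0 < t := hx.trans ht
    rw [rpow_neg ht'.le, norm_div, norm_pow, div_eq_mul_inv]
    simp only [rpow_ofNat, norm_eq_abs, abs_of_pos ht']
    have := abs_sin_le_one t
    have h2 : 0 < (t ^ 2)⁻¹ := by positivity
    nlinarith
  have h1 := intervalIntegral_tendsto_integral_Ioi x hi tendsto_id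
  have h2 : Tendsto (fun b : ℝ => sin b / b) atTop (𝓝 0) := by
    refine squeeze_zero_norm' (a := fun b : ℝ => b⁻¹) ?_ tendsto_inv_atTop_zero
    filter_upwards [eventually_gt_atTop 0] with b hb
    rw [norm_div, div_eq_mul_inv, norm_eq_abs, norm_eq_abs, abs_of_pos hb]
    have := abs_sin_le_one b
    have h2 : 0 < b⁻¹ := by positivity
    nlinarith
  have h3 := (h2.sub_const (sin x / x)).add h1
  have h4 : Tendsto (fun b : ℝ => ∫ t in x..b, Real.cos t / t) atTop
      (𝓝 (0 - sin x / x + ∫ t in Set.Ioi x, sin t / t ^ 2)) := by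
    refine h3.congr' ?_
    filter_upwards [eventually_gt_atTop x] with b hb
    have hpos : ∀ t ∈ Set.uIcc x b, t ≠ 0 := by
      intro t ht
      rw [Set.uIcc_of_le hb.le] at ht
      exact (hx.trans_le ht.1).ne'
    have := intervalIntegral.integral_mul_deriv_eq_deriv_mul (a := x) (b := b)
      (u := fun t : ℝ => t⁻¹) (u' := fun t => -(t ^ 2)⁻¹) (v := sin) (v' := cos)
      (fun t ht => hasDerivAt_inv (hpos t ht)) (fun t _ => hasDerivAt_sin t)
      (ContinuousOn.intervalIntegrable (by
        refine ContinuousOn.neg (ContinuousOn.inv₀ (by fun_prop) ?_)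
        intro t ht; exact pow_ne_zero _ (hpos t ht)))
      (continuous_cos.intervalIntegrable _ _)
    have e1 : (∫ t in x..b, cos t / t) = ∫ t in x..b, t⁻¹ * cos t := by
      congr 1; ext t; ring
    have e2 : (∫ t in x..b, -(t ^ 2)⁻¹ * sin t) = - ∫ t in x..b, sin t / t ^ 2 := by
      rw [← intervalIntegral.integral_neg]; congr 1; ext t; ring
    rw [e1, this, e2]
    simp only [id]
    ring
  unfold Ci
  rw [neg_neg]
  exact tendsto_nhds_limUnder ⟨_, h4⟩

lemma sum_sin_mul (N : ℕ) (t : ℝ) :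
    (∑ k ∈ Finset.range N, sin ((2 * k + 1) * t)) * (2 * sin t) = 1 - cos (2 * N * t) := by
  induction N with
  | zero => simp
  | succ n ih =>
    rw [Finset.sum_range_succ, add_mul, ih]
    push_cast
    have e1 : 2 * ((n : ℝ) + 1) * t = (2 * n + 1) * t + t := by ring
    have e2 : 2 * (n : ℝ) * t = (2 * n + 1) * t - t := by ring
    rw [e1, e2, cos_add, cos_sub]
    ring

lemma sum_odd (N : ℕ) : (∑ k ∈ Finset.range N, 1 / (2 * (k : ℝ) + 1)) =
    ∫ t in (0 : ℝ)..(π / 2), (1 - cos (2 * N * t)) / (2 * sin t) := by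
  have h : ∀ t ∈ Set.uIoc 0 (π / 2), (1 - cos (2 * N * t)) / (2 * sin t) =
      ∑ k ∈ Finset.range N, sin ((2 * k + 1) * t) := by
    intro t ht
    rw [Set.uIoc_of_le (by positivity)] at ht
    have : 0 < sin t := sin_pos_of_pos_of_lt_pi ht.1 (by linarith [ht.2, pi_pos])
    rw [← sum_sin_mul, mul_div_cancel_right₀ _ (by positivity)]
  rw [intervalIntegral.integral_congr_ae (Eventually.of_forall h), intervalIntegral.integral_finsetSum]
  · refine Finset.sum_congr rfl fun k _ => ?_
    have hk : (2 * (k : ℝ) + 1) ≠ 0 := by positivity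
    rw [intervalIntegral.integral_comp_mul_left _ hk, integral_sin]
    have : (2 * (k : ℝ) + 1) * (π / 2) = π / 2 + k * π := by ring
    rw [this, cos_add_nat_mul_pi]
    simp
  · intro k _
    exact Continuous.intervalIntegrable (by fun_prop) _ _

lemma sum_odd_harm (N : ℕ) : (∑ k ∈ Finset.range N, 1 / (2 * (k : ℝ) + 1)) =
    (harmonic (2 * N) : ℝ) - (harmonic N : ℝ) / 2 := by
  induction N with
  | zero => simp
  | succ n ih =>
    rw [Finset.sum_range_succ, ih, show 2 * (n + 1) = 2 * n + 1 + 1 by ring, harmonic_succ,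
      harmonic_succ, harmonic_succ]
    push_cast
    field_simp
    ring

/-- the difference kernel -/
noncomputable def kern (t : ℝ) : ℝ := 1 / sin t - 1 / t

lemma kern_bdd {t : ℝ} (ht : t ∈ Set.uIoc 0 (π / 2)) : |kern t| ≤ 1 := by
  rw [Set.uIoc_of_le (by positivity)] at ht
  have hs : 0 < sin t := sin_pos_of_pos_of_lt_pi ht.1 (by linarith [ht.2, pi_pos])
  have hst : sin t ≤ t := sin_le ht.1.le
  have hc : 0 ≤ cos t := cos_nonneg_of_neg_pi_div_two_le_of_le (by linarith [ht.1, pi_pos]) ht.2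
  have h1 : t * cos t ≤ sin t := by
    rcases ht.2.eq_or_lt with h | h
    · rw [h]; simp
    · have := lt_tan ht.1 h
      have hc' := cos_pos_of_mem_Ioo ⟨by linarith [ht.1, pi_pos], h⟩
      rw [tan_eq_sin_div_cos, lt_div_iff₀ hc'] at this
      exact this.le
  have h0 : 0 < t := ht.1
  unfold kern
  rw [abs_of_nonneg (by rw [sub_nonneg]; exact one_div_le_one_div_of_le hs hst)]
  rw [div_sub_div _ _ hs.ne' h0.ne', div_le_one (by positivity)]
  have h2 : 1 ≤ sin t + cos t := by
    nlinarith [sin_sq_add_cos_sq t, mul_nonneg hs.le hc]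
  nlinarith

lemma kern_int : IntervalIntegrable kern volume 0 (π / 2) :=
  ii_of_bdd (by unfold kern; fun_prop) _ _ fun _ => kern_bdd

lemma kern_integral : ∫ t in (0 : ℝ)..(π / 2), kern t = log (4 / π) := by
  have hF : ∀ t : ℝ, 0 < t → t ≤ π / 2 →
      HasDerivAt (fun t => log (sin (t / 2) / t / cos (t / 2))) (kern t) t := by
    intro t h0 h1
    have hs : 0 < sin (t / 2) := sin_pos_of_pos_of_lt_pi (by linarith) (by linarith [pi_pos])
    have hc : 0 < cos (t / 2) := cos_pos_of_mem_Ioo ⟨by linarith [pi_pos], by linarith⟩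
    have d0 : HasDerivAt (fun t : ℝ => t / 2) (1 / 2) t := (hasDerivAt_id t).div_const 2
    have d := (((d0.sin).div (hasDerivAt_id t) h0.ne').div d0.cos hc.ne').log (by
      simp only [Pi.div_apply, id]; positivity)
    refine d.congr_deriv ?_
    have e : sin t = 2 * sin (t / 2) * cos (t / 2) := by
      rw [← sin_two_mul]; congr 1; ring
    unfold kern
    rw [e]
    simp only [id, Pi.div_apply]
    field_simp
    have := sin_sq_add_cos_sq (t / 2)
    linear_combination t * this
  have hlim : Tendsto (fun t : ℝ => log (sin (t / 2) / t / cos (t / 2))) (𝓝[>] 0)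
      (𝓝 (log (1 / 2))) := by
    have d0 : HasDerivAt (fun t : ℝ => sin (t / 2)) (1 / 2) 0 := by
      have d0 : HasDerivAt (fun t : ℝ => t / 2) (1 / 2) 0 := (hasDerivAt_id (0:ℝ)).div_const 2
      simpa using d0.sin
    have d1 := d0.tendsto_slope.mono_left (nhdsWithin_mono (0 : ℝ) (s := Set.Ioi 0)
      (fun t ht => ne_of_gt ht))
    have d2 : Tendsto (fun t : ℝ => cos (t / 2)) (𝓝[>] 0) (𝓝 1) := by
      have : Continuous fun t : ℝ => cos (t / 2) := by fun_prop
      simpa using (this.tendsto 0).mono_left nhdsWithin_le_nhds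
    have d3 := ((d1.div d2 one_ne_zero).log (by norm_num))
    simp only [div_one] at d3
    refine d3.congr fun t => ?_
    simp [slope_def_field]
  have hpi := pi_pos
  have hR : Tendsto (fun t : ℝ => log (sin (t / 2) / t / cos (t / 2))) (𝓝[<] (π / 2))
      (𝓝 (log (2 / π))) := by
    have h := (hF (π / 2) (by positivity) le_rfl).continuousAt.tendsto.mono_left
      (nhdsWithin_le_nhds (s := Set.Iio (π / 2)))
    convert h using 3
    rw [show π / 2 / 2 = π / 4 by ring, sin_pi_div_four, cos_pi_div_four]
    field_simp
  rw [intervalIntegral.integral_eq_sub_of_hasDerivAt_of_tendsto (by positivity)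
    (fun t ht => hF t ht.1 ht.2.le) kern_int hlim hR, ← log_div (by positivity) (by norm_num)]
  congr 1
  field_simp
  norm_num

lemma kern_RL : Tendsto (fun N : ℕ => ∫ t in (0 : ℝ)..(π / 2), cos (2 * N * t) * kern t) atTop
    (𝓝 0) := by
  set f : ℝ → ℂ := (Set.uIoc 0 (π / 2)).indicator (fun t => (kern t : ℂ)) with hf
  have h := Real.tendsto_integral_exp_smul_cocompact f
  have hN : Tendsto (fun N : ℕ => (N : ℝ) / π) atTop (cocompact ℝ) :=
    (tendsto_natCast_atTop_atTop.atTop_div_const pi_pos).mono_right atTop_le_cocompact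
  have h2 := (Complex.continuous_re.tendsto 0).comp (h.comp hN)
  simp only [Complex.zero_re] at h2
  refine h2.congr fun N => ?_
  have hfi : Integrable f := by
    rw [hf, integrable_indicator_iff measurableSet_uIoc]
    exact (intervalIntegrable_iff.1 kern_int).ofReal
  have hfi2 : Integrable (fun v : ℝ => Real.fourierChar (-(v * (N / π))) • f v) := by
    refine hfi.mono ?_ (Eventually.of_forall fun v => ?_)
    · refine AEStronglyMeasurable.smul (Continuous.aestronglyMeasurable ?_) hfi.1
      fun_prop
    · rw [Circle.norm_smul]
  have e := Complex.reCLM.integral_comp_comm hfi2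
  simp only [Complex.reCLM_apply] at e
  simp only [Function.comp]
  rw [← e, intervalIntegral.integral_of_le (by positivity), ← Set.uIoc_of_le (by positivity),
    ← integral_indicator measurableSet_uIoc]
  congr 1
  ext v
  by_cases hv : v ∈ Set.uIoc 0 (π / 2)
  · rw [hf, Set.indicator_of_mem hv, Set.indicator_of_mem hv, Circle.smul_def, smul_eq_mul,
      Complex.re_mul_ofReal, Real.fourierChar_apply]
    congr 1
    have : ((2 * π * -(v * (N / π)) : ℝ) : ℂ) = ((-(2 * N * v) : ℝ) : ℂ) := by
      congr 1
      field_simp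
    rw [this, Complex.exp_ofReal_mul_I_re, cos_neg]
  · rw [hf, Set.indicator_of_notMem hv, Set.indicator_of_notMem hv]
    simp

lemma cin_asymp : Tendsto (fun N : ℕ => (∫ t in (0 : ℝ)..(N * π), (1 - cos t) / t) - log (N * π))
    atTop (𝓝 eulerMascheroniConstant) := by
  have hH := tendsto_harmonic_sub_log
  have hH2 := hH.comp (tendsto_id.const_mul_atTop' (show 0 < 2 by norm_num))
  have key := (((hH2.const_mul 2).sub hH).sub_const (log (4 / π))).add kern_RL
  have key2 := key.add_const (log 4 - log π)
  have hc : 2 * eulerMascheroniConstant - eulerMascheroniConstant - log (4 / π) + 0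
      + (log 4 - log π) = eulerMascheroniConstant := by
    rw [log_div (by norm_num) pi_ne_zero]; ring
  rw [hc] at key2
  refine key2.congr' ?_
  filter_upwards [eventually_gt_atTop 0] with N hN
  have hN' : (0 : ℝ) < N := by exact_mod_cast hN
  have hsum := (sum_odd_harm N).symm.trans (sum_odd N)
  have e1 : (∫ t in (0 : ℝ)..(N * π), (1 - cos t) / t) =
      ∫ t in (0 : ℝ)..(π / 2), (1 - cos (2 * N * t)) / t := by
    have := intervalIntegral.mul_integral_comp_mul_left (a := 0) (b := π / 2)
      (f := fun t : ℝ => (1 - cos t) / t) (2 * N : ℝ)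
    rw [mul_zero, show 2 * (N : ℝ) * (π / 2) = N * π by ring] at this
    rw [← this, ← intervalIntegral.integral_const_mul]
    congr 1
    ext t
    rcases eq_or_ne t 0 with rfl | ht
    · simp
    · field_simp
  have e2 : (∫ t in (0 : ℝ)..(π / 2), (1 - cos (2 * N * t)) / (2 * sin t)) =
      (1 / 2) * ((∫ t in (0 : ℝ)..(π / 2), (1 - cos (2 * N * t)) / t) + (log (4 / π) -
        ∫ t in (0 : ℝ)..(π / 2), cos (2 * N * t) * kern t)) := by
    have i2 : IntervalIntegrable (fun t => cos (2 * N * t) * kern t) volume 0 (π / 2) :=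
      kern_int.continuousOn_mul (by fun_prop)
    rw [← kern_integral, ← intervalIntegral.integral_sub kern_int i2,
      ← intervalIntegral.integral_add (cin_int _ _ _) (kern_int.sub i2),
      ← intervalIntegral.integral_const_mul]
    congr 1
    ext t
    unfold kern
    simp only [div_eq_mul_inv, mul_inv]
    ring
  rw [e1]
  rw [e2] at hsum
  simp only [Function.comp, id]
  push_cast
  rw [log_mul hN'.ne' pi_ne_zero, log_mul (by norm_num) hN'.ne']
  have l4 : log 4 = 2 * log 2 := by
    rw [show (4 : ℝ) = 2 ^ 2 by norm_num, log_pow]; norm_num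
  rw [l4]
  linarith

lemma Ci_eq {x : ℝ} (hx : 0 < x) :
    Ci x = eulerMascheroniConstant + log x - ∫ t in (0 : ℝ)..x, (1 - cos t) / t := by
  have hN : Tendsto (fun N : ℕ => (N : ℝ) * π) atTop atTop :=
    tendsto_natCast_atTop_atTop.atTop_mul_const pi_pos
  have h1 := (Ci_exists hx).comp hN
  have h2 := (cin_asymp.neg).add_const ((∫ t in (0 : ℝ)..x, (1 - cos t) / t) - log x)
  have hi : ∀ a b : ℝ, IntervalIntegrable (fun t => (1 - cos t) / t) volume a b := by
    intro a b; simpa using cin_int 1 a b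
  have h3 := h2.congr' (f₂ := (fun b : ℝ => ∫ t in x..b, Real.cos t / t) ∘ fun N : ℕ => (N : ℝ) * π) (by
    filter_upwards [hN.eventually_gt_atTop x] with N hb
    simp only [Function.comp]
    have hb0 := hx.trans hb
    have e : (∫ t in x..(N * π), cos t / t) = (∫ t in x..(N * π), t⁻¹) -
        ∫ t in x..(N * π), (1 - cos t) / t := by
      rw [← intervalIntegral.integral_sub _ (hi _ _)]
      · congr 1; ext t; ring
      · refine intervalIntegral.intervalIntegrable_inv (fun t ht => ?_) continuousOn_id
        rw [Set.uIcc_of_le hb.le] at ht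
        exact (hx.trans_le ht.1).ne'
    rw [e, integral_inv_of_pos hx hb0, log_div hb0.ne' hx.ne',
      ← intervalIntegral.integral_add_adjacent_intervals (hi 0 x) (hi x (N * π))]
    ring)
  have := tendsto_nhds_unique h1 h3
  linarith

lemma hasSum_log : HasSum (fun n : ℕ => log ((n : ℝ) + 1) / ((n : ℝ) + 1) ^ 2)
    (-(deriv riemannZeta 2).re) ∧ (((deriv riemannZeta 2).re : ℝ) : ℂ) = deriv riemannZeta 2 := by
  have ha : LSeries.abscissaOfAbsConv 1 < ((2 : ℂ).re : EReal) := by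
    rw [LSeries.abscissaOfAbsConv_one]
    norm_num
    exact_mod_cast (by norm_num : (1 : ℝ) < 2)
  have hd := LSeries_deriv ha
  have hs := (LSeriesSummable_logMul_of_lt_re ha).LSeriesHasSum
  have hz : deriv (LSeries 1) 2 = deriv riemannZeta 2 := by
    refine Filter.EventuallyEq.deriv_eq <| Filter.eventuallyEq_iff_exists_mem.mpr ?_
    exact ⟨{z | 1 < z.re}, (isOpen_lt continuous_const Complex.continuous_re).mem_nhds (by simp),
      fun _ => LSeries_one_eq_riemannZeta⟩
  rw [hz] at hd
  rw [← neg_neg (LSeries (LSeries.logMul 1) 2), ← hd] at hs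
  have h2 : HasSum (fun n : ℕ => ((log (n : ℝ) / (n : ℝ) ^ 2 : ℝ) : ℂ)) (-deriv riemannZeta 2) := by
    refine hasSum_cast hs (fun n => ?_) rfl
    rcases eq_or_ne n 0 with rfl | hn
    · simp
    · rw [LSeries.term_of_ne_zero hn]
      simp [LSeries.logMul, Complex.natCast_log]
  have h3 := Complex.hasSum_re h2
  simp only [Complex.ofReal_re, Complex.neg_re] at h3
  have h4 := Complex.hasSum_im h2
  simp only [Complex.ofReal_im, Complex.neg_im] at h4
  have h5 := h4.unique hasSum_zero
  refine ⟨?_, Complex.ext (by simp) (by simp; linarith)⟩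
  have := (hasSum_nat_add_iff' 1).2 h3
  simpa using this

lemma hasSum_cos_part : HasSum (fun n : ℕ => (∫ t in (0 : ℝ)..(2 * ((n : ℝ) + 1) * π),
    (1 - cos t) / t) / ((n : ℝ) + 1) ^ 2) (π ^ 2 / 2) := by
  have hz : ∀ u ∈ Set.Icc (0 : ℝ) 1, HasSum (fun n : ℕ => (1 - cos (2 * ((n : ℝ) + 1) * π * u)) /
      ((n : ℝ) + 1) ^ 2) (π ^ 2 * (u - u ^ 2)) := by
    intro u hu
    have h1 := hasSum_one_div_nat_pow_mul_cos one_ne_zero hu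
    have h2 := hasSum_zeta_two.sub h1
    have h3 := (hasSum_nat_add_iff' 1).2 h2
    refine hasSum_cast h3 (fun n => ?_) ?_
    · push_cast
      rw [show 2 * π * ((n : ℝ) + 1) * u = 2 * ((n : ℝ) + 1) * π * u by ring]
      ring
    · simp [Polynomial.bernoulli, Finset.sum_range_succ, _root_.bernoulli_two, _root_.bernoulli_one,
        Nat.factorial]
      ring
  have key : HasSum (fun n : ℕ => ∫ u in (0 : ℝ)..1,
      (1 - cos (2 * ((n : ℝ) + 1) * π * u)) / u / ((n : ℝ) + 1) ^ 2)
      (∫ u in (0 : ℝ)..1, π ^ 2 * (1 - u)) := by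
    have hs : ∀ u ∈ Set.uIoc (0 : ℝ) 1, HasSum (fun n : ℕ =>
        (1 - cos (2 * ((n : ℝ) + 1) * π * u)) / u / ((n : ℝ) + 1) ^ 2) (π ^ 2 * (1 - u)) := by
      intro u hu
      rw [Set.uIoc_of_le zero_le_one] at hu
      have h := (hz u ⟨hu.1.le, hu.2⟩).div_const u
      have hu0 := hu.1.ne'
      refine hasSum_cast h (fun n => ?_) ?_
      · rw [div_right_comm]
      · field_simp
    refine intervalIntegral.hasSum_integral_of_dominated_convergence
      (fun n u => (1 - cos (2 * ((n : ℝ) + 1) * π * u)) / u / ((n : ℝ) + 1) ^ 2) ?_ ?_ ?_ ?_ ?_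
    · intro n
      exact Measurable.aestronglyMeasurable (by fun_prop)
    · intro n
      refine Eventually.of_forall fun u hu => ?_
      rw [Set.uIoc_of_le zero_le_one] at hu
      have h0 := hu.1
      have h1 : 0 ≤ 1 - cos (2 * ((n : ℝ) + 1) * π * u) := by
        linarith [cos_le_one (2 * ((n : ℝ) + 1) * π * u)]
      rw [norm_eq_abs, abs_of_nonneg (by positivity)]
    · exact Eventually.of_forall fun u hu => (hs u hu).summable
    · refine IntervalIntegrable.congr (f := fun u : ℝ => π ^ 2 * (1 - u)) ?_ ?_
      · intro u hu
        exact (hs u hu).tsum_eq.symm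
      · exact Continuous.intervalIntegrable (by fun_prop) _ _
    · exact Eventually.of_forall hs
  convert key using 1
  · ext n
    rw [intervalIntegral.integral_div]
    congr 1
    have hn : (0 : ℝ) < 2 * ((n : ℝ) + 1) * π := by positivity
    have := intervalIntegral.mul_integral_comp_mul_left (a := 0) (b := 1)
      (f := fun t : ℝ => (1 - cos t) / t) (2 * ((n : ℝ) + 1) * π)
    rw [mul_zero, mul_one] at this
    rw [← this, ← intervalIntegral.integral_const_mul]
    congr 1
    ext t
    rcases eq_or_ne t 0 with rfl | ht
    · simp
    · field_simp
  · rw [intervalIntegral.integral_const_mul, intervalIntegral.integral_sub (by simp) (by simp)]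
    simp
    ring

/-- `∑_{n=1}^∞ Ci(2nπ)/n² = ζ(2)(γ + log(2π)) − ζ'(2) − π²/2`, the series converging
(and the improper integrals defining `Ci` converging). -/
theorem tsum_cosIntegral_div_sq :
    (∀ x : ℝ, 0 < x →
      Tendsto (fun b : ℝ => ∫ t in x..b, Real.cos t / t) atTop (𝓝 (-Ci x))) ∧
    ∃ S : ℝ,
      HasSum (fun n : ℕ => Ci (2 * ((n : ℝ) + 1) * π) / ((n : ℝ) + 1) ^ 2) S ∧
      (S : ℂ) = riemannZeta 2 *
          ((Real.eulerMascheroniConstant : ℂ) + (Real.log (2 * π) : ℂ)) -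
        deriv riemannZeta 2 - (π : ℂ) ^ 2 / 2 := by
  refine ⟨fun x hx => Ci_exists hx, π ^ 2 / 6 * (eulerMascheroniConstant + log (2 * π)) +
    -(deriv riemannZeta 2).re - π ^ 2 / 2, ?_, ?_⟩
  · have hz : HasSum (fun n : ℕ => (1 : ℝ) / ((n : ℝ) + 1) ^ 2) (π ^ 2 / 6) := by
      simpa using (hasSum_nat_add_iff' 1).2 hasSum_zeta_two
    have h := ((hz.mul_right (eulerMascheroniConstant + log (2 * π))).add hasSum_log.1).sub
      hasSum_cos_part
    refine hasSum_cast h (fun n => ?_) rfl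
    have hn : (0 : ℝ) < (n : ℝ) + 1 := by positivity
    rw [Ci_eq (by positivity), show 2 * ((n : ℝ) + 1) * π = 2 * π * ((n : ℝ) + 1) by ring,
      log_mul (by positivity) hn.ne']
    ring
  · rw [riemannZeta_two]
    push_cast
    rw [hasSum_log.2]
    ring
end

section
/- For every real t > 0, the improper integral ∫_0^∞ [ψ(t+u) − log(t+u) + 1/(2(t+u))] du converges and equals (t − 1/2)·log t − t + (1/2)·log(2π) − log Γ(t). In particular, taking t = 1, ∫_0^∞ [ψ(1+u) − log(1+u) + 1/(2(1+u))] du = (1/2)·log(2π) − 1. -/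
open Real Filter MeasureTheory Topology

/-- The digamma function `ψ(x) = Γ'(x)/Γ(x)`. -/
noncomputable def digamma (x : ℝ) : ℝ := deriv Real.Gamma x / Real.Gamma x

theorem dg_hasDeriv (x : ℝ) (hx : 0 < x) :
    HasDerivAt (fun y => Real.log (Real.Gamma y)) (digamma x) x := by
  have h : DifferentiableAt ℝ Real.Gamma x := by
    apply Real.differentiableAt_Gamma
    intro m hm
    have : (0 : ℝ) ≤ m := Nat.cast_nonneg m
    linarith
  exact h.hasDerivAt.log (Real.Gamma_pos_of_pos hx).ne'

theorem dg_Gamma_add_one (x : ℝ) (hx : 0 < x) :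
    Real.log (Real.Gamma (x + 1)) = Real.log x + Real.log (Real.Gamma x) := by
  rw [Real.Gamma_add_one hx.ne', Real.log_mul hx.ne' (Real.Gamma_pos_of_pos hx).ne']

theorem dg_add_one (x : ℝ) (hx : 0 < x) : digamma (x + 1) = digamma x + 1 / x := by
  have h1 : HasDerivAt (fun y => Real.log (Real.Gamma (y + 1))) (digamma (x + 1)) x :=
    (dg_hasDeriv (x + 1) (by linarith)).comp_add_const x 1
  have h2 : HasDerivAt (fun y => Real.log y + Real.log (Real.Gamma y)) (x⁻¹ + digamma x) x :=
    (Real.hasDerivAt_log hx.ne').add (dg_hasDeriv x hx)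
  have h3 : (fun y => Real.log (Real.Gamma (y + 1))) =ᶠ[𝓝 x]
      (fun y => Real.log y + Real.log (Real.Gamma y)) := by
    filter_upwards [lt_mem_nhds hx] with y hy
    exact dg_Gamma_add_one y hy
  have := h1.unique (h2.congr_of_eventuallyEq h3)
  rw [this, one_div, add_comm]

theorem dg_le_log (x : ℝ) (hx : 0 < x) : digamma x ≤ Real.log x := by
  have h := Real.convexOn_log_Gamma.le_slope_of_hasDerivAt (x := x) (y := x + 1)
    (Set.mem_Ioi.2 hx) (Set.mem_Ioi.2 (by linarith)) (by linarith) (dg_hasDeriv x hx)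
  rw [slope_def_field] at h
  simp only [Function.comp, dg_Gamma_add_one x hx] at h
  simpa using h

theorem dg_step (x : ℝ) (hx : 0 < x) :
    digamma x - Real.log x + 1 / (2 * x) ≤
      digamma (x + 1) - Real.log (x + 1) + 1 / (2 * (x + 1)) := by
  have hx1 : 0 < x + 1 := by linarith
  have hz : 0 < (x + 1) / x := by positivity
  have h1 : 0 ≤ Real.log ((x + 1) / x) := by
    apply Real.log_nonneg
    rw [le_div_iff₀ hx]; linarith
  have h2 := Real.self_le_sinh_iff.2 h1
  rw [Real.sinh_log hz, Real.log_div hx1.ne' hx.ne'] at h2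
  have h3 : ((x + 1) / x - ((x + 1) / x)⁻¹) / 2 = 1 / x + 1 / (2 * (x + 1)) - 1 / (2 * x) := by
    field_simp
    ring
  rw [h3] at h2
  rw [dg_add_one x hx]
  linarith

theorem dg_nonpos (x : ℝ) (hx : 0 < x) : digamma x - Real.log x + 1 / (2 * x) ≤ 0 := by
  have h : ∀ n : ℕ, digamma x - Real.log x + 1 / (2 * x) ≤
      digamma (x + n) - Real.log (x + n) + 1 / (2 * (x + n)) := by
    intro n
    induction n with
    | zero => simp
    | succ k ih =>
      refine ih.trans ?_
      have := dg_step (x + k) (by positivity)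
      push_cast
      rw [← add_assoc]
      exact this
  have h2 : ∀ n : ℕ, digamma x - Real.log x + 1 / (2 * x) ≤ 1 / (2 * (x + n)) := by
    intro n
    have := dg_le_log (x + n) (by positivity)
    linarith [h n]
  have h3 : Tendsto (fun n : ℕ => 1 / (2 * (x + (n : ℝ)))) atTop (𝓝 0) := by
    simp only [one_div]
    apply Tendsto.inv_tendsto_atTop
    apply Tendsto.const_mul_atTop (by norm_num)
    exact tendsto_atTop_add_const_left _ _ tendsto_natCast_atTop_atTop
  exact ge_of_tendsto' h3 h2

/-- The antiderivative. -/
noncomputable def dgF (x : ℝ) : ℝ := Real.log (Real.Gamma x) - (x - 1 / 2) * Real.log x + x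

theorem dgF_hasDeriv (x : ℝ) (hx : 0 < x) :
    HasDerivAt dgF (digamma x - Real.log x + 1 / (2 * x)) x := by
  have h := ((dg_hasDeriv x hx).sub (((hasDerivAt_id x).sub_const (1 / 2)).mul
    (Real.hasDerivAt_log hx.ne'))).add (hasDerivAt_id x)
  refine h.congr_deriv ?_
  simp only [id]
  field_simp
  ring

theorem dgF_anti : AntitoneOn dgF (Set.Ioi 0) := by
  apply antitoneOn_of_deriv_nonpos (convex_Ioi 0)
  · intro x hx
    exact (dgF_hasDeriv x hx).continuousAt.continuousWithinAt
  · rw [interior_Ioi]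
    intro x hx
    exact (dgF_hasDeriv x hx).differentiableAt.differentiableWithinAt
  · rw [interior_Ioi]
    intro x hx
    rw [(dgF_hasDeriv x hx).deriv]
    exact dg_nonpos x hx

theorem dgF_nat : Tendsto (fun n : ℕ => dgF n) atTop (𝓝 ((1 / 2) * Real.log (2 * π))) := by
  have h1 : Tendsto (fun n : ℕ => Real.log (Stirling.stirlingSeq n) + (1 / 2) * Real.log 2) atTop
      (𝓝 (Real.log (√π) + (1 / 2) * Real.log 2)) :=
    ((Real.continuousAt_log (by positivity)).tendsto.comp
      Stirling.tendsto_stirlingSeq_sqrt_pi).add_const _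
  have h2 : Real.log (√π) + (1 / 2) * Real.log 2 = (1 / 2) * Real.log (2 * π) := by
    rw [Real.log_sqrt Real.pi_pos.le, Real.log_mul (by norm_num) Real.pi_ne_zero]; ring
  rw [← h2]
  refine h1.congr' ?_
  filter_upwards [eventually_gt_atTop 0] with n hn
  have hn' : (0 : ℝ) < n := by exact_mod_cast hn
  have h3 := dg_Gamma_add_one n hn'
  rw [Real.Gamma_nat_eq_factorial] at h3
  rw [Stirling.log_stirlingSeq_formula, dgF, h3, Real.log_mul (by norm_num) hn'.ne',
    Real.log_div hn'.ne' (Real.exp_pos 1).ne', Real.log_exp]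
  ring

theorem dgF_tendsto : Tendsto dgF atTop (𝓝 ((1 / 2) * Real.log (2 * π))) := by
  have ha : Antitone (fun x => dgF (max x 1)) := by
    intro a b hab
    apply dgF_anti
    · exact Set.mem_Ioi.2 (lt_of_lt_of_le (one_pos : (0 : ℝ) < 1) (le_max_right _ _))
    · exact Set.mem_Ioi.2 (lt_of_lt_of_le (one_pos : (0 : ℝ) < 1) (le_max_right _ _))
    · exact max_le_max_right _ hab
  have h : Tendsto (fun x => dgF (max x 1)) atTop (𝓝 ((1 / 2) * Real.log (2 * π))) := by
    rw [tendsto_iff_tendsto_subseq_of_antitone ha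
      (tendsto_natCast_atTop_atTop (R := ℝ))]
    refine dgF_nat.congr' ?_
    filter_upwards [eventually_ge_atTop 1] with n hn
    have hn' : (1 : ℝ) ≤ n := by exact_mod_cast hn
    simp [max_eq_left hn']
  refine h.congr' ?_
  filter_upwards [eventually_ge_atTop 1] with x hx
  rw [max_eq_left hx]

/-- For every real `t > 0`, `∫_0^∞ [ψ(t+u) − log(t+u) + 1/(2(t+u))] du` converges and
equals `(t − 1/2) log t − t + (1/2) log(2π) − log Γ(t)`; in particular, for `t = 1`,
`∫_0^∞ [ψ(1+u) − log(1+u) + 1/(2(1+u))] du = (1/2) log(2π) − 1`. -/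
theorem integral_digamma_sub_log_add_inv :
    (∀ t : ℝ, 0 < t →
      IntegrableOn (fun u : ℝ => digamma (t + u) - Real.log (t + u) + 1 / (2 * (t + u)))
        (Set.Ioi 0) ∧
      ∫ u in Set.Ioi (0 : ℝ), (digamma (t + u) - Real.log (t + u) + 1 / (2 * (t + u))) =
        (t - 1 / 2) * Real.log t - t + (1 / 2) * Real.log (2 * π) -
          Real.log (Real.Gamma t)) ∧
    ∫ u in Set.Ioi (0 : ℝ), (digamma (1 + u) - Real.log (1 + u) + 1 / (2 * (1 + u))) =
      (1 / 2) * Real.log (2 * π) - 1 := by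
  have main : ∀ t : ℝ, 0 < t →
      IntegrableOn (fun u : ℝ => digamma (t + u) - Real.log (t + u) + 1 / (2 * (t + u)))
        (Set.Ioi 0) ∧
      ∫ u in Set.Ioi (0 : ℝ), (digamma (t + u) - Real.log (t + u) + 1 / (2 * (t + u))) =
        (t - 1 / 2) * Real.log t - t + (1 / 2) * Real.log (2 * π) -
          Real.log (Real.Gamma t) := by
    intro t ht
    have hd : ∀ u ∈ Set.Ici (0 : ℝ), HasDerivAt (fun u => dgF (t + u))
        (digamma (t + u) - Real.log (t + u) + 1 / (2 * (t + u))) u := by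
      intro u hu
      exact (dgF_hasDeriv (t + u) (add_pos_of_pos_of_nonneg ht hu)).comp_const_add t u
    have hn : ∀ u ∈ Set.Ioi (0 : ℝ),
        digamma (t + u) - Real.log (t + u) + 1 / (2 * (t + u)) ≤ 0 :=
      fun u hu => dg_nonpos _ (add_pos ht hu)
    have hl : Tendsto (fun u => dgF (t + u)) atTop (𝓝 ((1 / 2) * Real.log (2 * π))) :=
      dgF_tendsto.comp (tendsto_atTop_add_const_left _ _ tendsto_id)
    refine ⟨integrableOn_Ioi_deriv_of_nonpos' hd hn hl, ?_⟩
    rw [integral_Ioi_of_hasDerivAt_of_nonpos' hd hn hl, add_zero, dgF]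
    ring
  refine ⟨main, ?_⟩
  rw [(main 1 one_pos).2]
  simp
  ring
end

section
/- For every integer p ≥ 2 and every real x > 0, the series ∑_{n=1}^∞ ψ^(p)(x+n) converges and ∑_{n=1}^∞ ψ^(p)(x+n) = −x·ψ^(p)(x) − p·ψ^(p−1)(x). -/
open Real Filter MeasureTheory Topology

lemma aux_summable {x : ℝ} (hx : 0 < x) {q : ℕ} (hq : 2 ≤ q) :
    Summable (fun k : ℕ => 1 / (x + (k : ℝ)) ^ q) := by
  have h := (Real.summable_one_div_nat_add_rpow x (q : ℝ)).2 (by exact_mod_cast hq)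
  refine h.congr fun k => ?_
  have h0 : (0 : ℝ) < x + k := by positivity
  rw [Real.rpow_natCast, add_comm (k : ℝ) x, abs_of_pos h0]

lemma aux_bound {a y : ℝ} (ha : 0 < a) (hy : a < y) (k q : ℕ) :
    1 / (y + (k : ℝ)) ^ q ≤ 1 / (a + (k : ℝ)) ^ q := by
  have : (0 : ℝ) < a + k := by positivity
  gcongr

lemma aux_hasDerivAt_term (q k : ℕ) {y : ℝ} (hy : 0 < y) :
    HasDerivAt (fun z : ℝ => 1 / (z + (k : ℝ)) ^ q) (-(q : ℝ) * (1 / (y + (k : ℝ)) ^ (q + 1))) y := by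
  have h0 : y + (k : ℝ) ≠ 0 := by positivity
  have h1 : HasDerivAt (fun z : ℝ => z + (k : ℝ)) 1 y := (hasDerivAt_id y).add_const _
  have h2 := (h1.pow q).inv (pow_ne_zero q h0)
  simp only [one_div]
  refine h2.congr_deriv ?_
  try simp only [Pi.pow_apply]
  rcases q with _ | q
  · simp
  · simp only [Nat.add_sub_cancel]
    field_simp
    ring

lemma aux_hasDerivAt_T {q : ℕ} (hq : 2 ≤ q) {x : ℝ} (hx : 0 < x) :
    HasDerivAt (fun z : ℝ => ∑' k : ℕ, 1 / (z + (k : ℝ)) ^ q)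
      (-(q : ℝ) * ∑' k : ℕ, 1 / (x + (k : ℝ)) ^ (q + 1)) x := by
  have ha : 0 < x / 2 := by positivity
  have hxa : x ∈ Set.Ioi (x / 2) := by simp only [Set.mem_Ioi]; linarith
  rw [← tsum_mul_left]
  refine hasDerivAt_tsum_of_isPreconnected
    (g := fun (k : ℕ) (z : ℝ) => 1 / (z + (k : ℝ)) ^ q)
    (g' := fun (k : ℕ) (z : ℝ) => -(q : ℝ) * (1 / (z + (k : ℝ)) ^ (q + 1)))
    (u := fun k : ℕ => (q : ℝ) * (1 / (x / 2 + (k : ℝ)) ^ (q + 1)))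
    ((aux_summable ha (by omega)).mul_left _) isOpen_Ioi isPreconnected_Ioi ?_ ?_ hxa
    (aux_summable hx hq) hxa
  · intro n y hy
    exact aux_hasDerivAt_term q n (ha.trans hy)
  · intro n y hy
    have hy0 : 0 < y := ha.trans hy
    have h0 : 0 ≤ 1 / (y + (n : ℝ)) ^ (q + 1) := by positivity
    rw [norm_mul, norm_neg, Real.norm_of_nonneg h0, Real.norm_natCast]
    exact mul_le_mul_of_nonneg_left (aux_bound ha hy n (q + 1)) (by positivity)

lemma aux_S {x : ℝ} (hx : 0 < x) :
    Summable (fun k : ℕ => 1 / (1 + (k : ℝ)) - 1 / (x + (k : ℝ))) ∧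
    HasDerivAt (fun z : ℝ => ∑' k : ℕ, (1 / (1 + (k : ℝ)) - 1 / (z + (k : ℝ))))
      (∑' k : ℕ, 1 / (x + (k : ℝ)) ^ 2) x := by
  obtain ⟨a, ha, hax, ha1⟩ : ∃ a : ℝ, 0 < a ∧ a < x ∧ a < 1 :=
    ⟨min x 1 / 2, by positivity, by linarith [min_le_left x 1, lt_min hx one_pos],
      by linarith [min_le_right x 1, lt_min hx one_pos]⟩
  have hg : ∀ (n : ℕ) (y : ℝ), y ∈ Set.Ioi a →
      HasDerivAt (fun z : ℝ => 1 / (1 + (n : ℝ)) - 1 / (z + (n : ℝ))) (1 / (y + (n : ℝ)) ^ 2) y := by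
    intro n y hy
    have := (aux_hasDerivAt_term 1 n (ha.trans hy)).const_sub (1 / (1 + (n : ℝ)))
    simpa using this
  have hg' : ∀ (n : ℕ) (y : ℝ), y ∈ Set.Ioi a →
      ‖1 / (y + (n : ℝ)) ^ 2‖ ≤ 1 / (a + (n : ℝ)) ^ 2 := by
    intro n y hy
    have h0 : 0 ≤ 1 / (y + (n : ℝ)) ^ 2 := by positivity
    rw [Real.norm_of_nonneg h0]
    exact aux_bound ha hy n 2
  have h1 : Summable (fun k : ℕ => 1 / (1 + (k : ℝ)) - 1 / ((1 : ℝ) + (k : ℝ))) := by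
    simp
  have m1 : (1 : ℝ) ∈ Set.Ioi a := ha1
  have mx : x ∈ Set.Ioi a := hax
  have hu : Summable (fun n : ℕ => 1 / (a + (n : ℝ)) ^ 2) := aux_summable ha le_rfl
  constructor
  · exact summable_of_summable_hasDerivAt_of_isPreconnected
      (g := fun (n : ℕ) (z : ℝ) => 1 / (1 + (n : ℝ)) - 1 / (z + (n : ℝ)))
      (g' := fun (n : ℕ) (y : ℝ) => 1 / (y + (n : ℝ)) ^ 2)
      hu isOpen_Ioi isPreconnected_Ioi hg hg' m1 h1 mx
  · exact hasDerivAt_tsum_of_isPreconnected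
      (g := fun (n : ℕ) (z : ℝ) => 1 / (1 + (n : ℝ)) - 1 / (z + (n : ℝ)))
      (g' := fun (n : ℕ) (y : ℝ) => 1 / (y + (n : ℝ)) ^ 2)
      hu isOpen_Ioi isPreconnected_Ioi hg hg' m1 h1 mx

lemma aux_diff {y : ℝ} (hy : 0 < y) : DifferentiableAt ℝ Real.Gamma y :=
  Real.differentiableAt_Gamma fun m => by
    have : (0 : ℝ) ≤ m := m.cast_nonneg
    intro h; linarith

lemma digamma_mono : MonotoneOn digamma (Set.Ioi 0) := by
  have h := Real.convexOn_log_Gamma.monotoneOn_deriv (fun y hy =>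
    (aux_diff hy).log (Real.Gamma_pos_of_pos hy).ne')
  refine h.congr fun y hy => ?_
  exact deriv.log (aux_diff hy) (Real.Gamma_pos_of_pos hy).ne'

lemma digamma_add_one' {y : ℝ} (hy : 0 < y) : digamma (y + 1) = digamma y + 1 / y := by
  have h : (fun z : ℝ => Real.Gamma (z + 1)) =ᶠ[𝓝 y] fun z => z * Real.Gamma z := by
    filter_upwards [lt_mem_nhds hy] with z hz
    exact Real.Gamma_add_one hz.ne'
  have h1 := h.deriv_eq
  have h2 : HasDerivAt (fun z : ℝ => z * Real.Gamma z) (1 * Real.Gamma y + y * deriv Real.Gamma y) y :=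
    (hasDerivAt_id' y).mul (aux_diff hy).hasDerivAt
  rw [deriv_comp_add_const, h2.deriv] at h1
  have hG := (Real.Gamma_pos_of_pos hy).ne'
  unfold digamma
  rw [h1, Real.Gamma_add_one hy.ne']
  field_simp
  ring

lemma digamma_add_nat {y : ℝ} (hy : 0 < y) (n : ℕ) :
    digamma (y + n) = digamma y + ∑ k ∈ Finset.range n, 1 / (y + (k : ℝ)) := by
  induction n with
  | zero => simp
  | succ n ih =>
    rw [Finset.sum_range_succ, ← add_assoc, ← ih, ← digamma_add_one' (by positivity)]
    push_cast
    ring_nf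

lemma digamma_limit {x : ℝ} (hx : 0 < x) :
    Tendsto (fun n : ℕ => digamma (x + n) - digamma (1 + n)) atTop (𝓝 0) := by
  obtain ⟨m, hm⟩ := exists_nat_ge x
  have hU : Tendsto (fun n : ℕ => (m : ℝ) * (1 / ((n : ℝ) + 1))) atTop (𝓝 0) := by
    simpa using (tendsto_one_div_add_atTop_nhds_zero_nat (𝕜 := ℝ)).const_mul (m : ℝ)
  have hL : Tendsto (fun n : ℕ => -(1 / (n : ℝ))) atTop (𝓝 0) := by
    simpa using (tendsto_one_div_atTop_nhds_zero_nat (𝕜 := ℝ)).neg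
  refine tendsto_of_tendsto_of_tendsto_of_le_of_le' hL hU ?_ ?_
  · filter_upwards [eventually_gt_atTop 0] with n hn
    have hn' : (0 : ℝ) < n := by exact_mod_cast hn
    have h1 := digamma_add_one' hn'
    have h2 : digamma n ≤ digamma (x + n) :=
      digamma_mono hn' (show (0 : ℝ) < x + n by positivity) (by linarith)
    rw [add_comm (1 : ℝ), h1]
    linarith
  · filter_upwards with n
    have h0 : (0 : ℝ) < 1 + n := by positivity
    have h1 := digamma_add_nat h0 m
    have h2 : digamma (x + n) ≤ digamma (1 + n + m) :=
      digamma_mono (show (0 : ℝ) < x + n by positivity)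
        (show (0 : ℝ) < 1 + n + m by positivity) (by linarith)
    have h3 : ∑ k ∈ Finset.range m, 1 / ((1 : ℝ) + n + (k : ℝ)) ≤ m * (1 / ((n : ℝ) + 1)) := by
      calc _ ≤ ∑ k ∈ Finset.range m, 1 / ((n : ℝ) + 1) := by
            refine Finset.sum_le_sum fun k _ => ?_
            apply one_div_le_one_div_of_le (by positivity)
            have : (0 : ℝ) ≤ k := k.cast_nonneg
            linarith
        _ = _ := by simp
    linarith

lemma digamma_eq {x : ℝ} (hx : 0 < x) :
    digamma x = digamma 1 + ∑' k : ℕ, (1 / (1 + (k : ℝ)) - 1 / (x + (k : ℝ))) := by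
  have h1 := (aux_S hx).1.hasSum.tendsto_sum_nat
  have h2 : Tendsto (fun n : ℕ => ∑ k ∈ Finset.range n, (1 / (1 + (k : ℝ)) - 1 / (x + (k : ℝ))))
      atTop (𝓝 (digamma x - digamma 1 - 0)) := by
    refine ((digamma_limit hx).const_sub (digamma x - digamma 1)).congr fun n => ?_
    rw [digamma_add_nat hx, digamma_add_nat one_pos, Finset.sum_sub_distrib]
    ring
  have := tendsto_nhds_unique h1 h2
  rw [this]; ring

lemma iteratedDeriv_digamma (p : ℕ) : ∀ x : ℝ, 0 < x →
    iteratedDeriv (p + 1) digamma x =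
      (-1) ^ p * ((p + 1).factorial : ℝ) * ∑' k : ℕ, 1 / (x + (k : ℝ)) ^ (p + 2) := by
  induction p with
  | zero =>
    intro x hx
    rw [zero_add, iteratedDeriv_one]
    have h : digamma =ᶠ[𝓝 x]
        fun z => digamma 1 + ∑' k : ℕ, (1 / (1 + (k : ℝ)) - 1 / (z + (k : ℝ))) := by
      filter_upwards [lt_mem_nhds hx] with z hz using digamma_eq hz
    rw [h.deriv_eq, ((aux_S hx).2.const_add _).deriv]
    simp
  | succ p ih =>
    intro x hx
    rw [iteratedDeriv_succ]
    have h : iteratedDeriv (p + 1) digamma =ᶠ[𝓝 x] fun z =>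
        (-1) ^ p * ((p + 1).factorial : ℝ) * ∑' k : ℕ, 1 / (z + (k : ℝ)) ^ (p + 2) := by
      filter_upwards [lt_mem_nhds hx] with z hz using ih z hz
    rw [h.deriv_eq, ((aux_hasDerivAt_T (q := p + 2) (by omega) hx).const_mul _).deriv,
      Nat.factorial_succ (p + 1)]
    push_cast
    ring

lemma aux_double {q : ℕ} (hq : 2 ≤ q) {x : ℝ} (hx : 0 < x) :
    HasSum (fun n : ℕ => ∑' k : ℕ, 1 / (x + ((n : ℝ) + 1) + (k : ℝ)) ^ (q + 1))
      ((∑' k : ℕ, 1 / (x + (k : ℝ)) ^ q) - x * ∑' k : ℕ, 1 / (x + (k : ℝ)) ^ (q + 1)) := by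
  have hA := (aux_summable hx hq).hasSum.sub
    ((aux_summable hx (q := q + 1) (by omega)).hasSum.mul_left x)
  have hB : HasSum (fun m : ℕ => (m : ℝ) * (1 / (x + (m : ℝ)) ^ (q + 1)))
      ((∑' k : ℕ, 1 / (x + (k : ℝ)) ^ q) - x * ∑' k : ℕ, 1 / (x + (k : ℝ)) ^ (q + 1)) := by
    suffices hE : (fun m : ℕ => (m : ℝ) * (1 / (x + (m : ℝ)) ^ (q + 1))) = fun m : ℕ =>
        1 / (x + (m : ℝ)) ^ q - x * (1 / (x + (m : ℝ)) ^ (q + 1)) by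
      rw [hE]; exact hA
    funext m
    have : x + (m : ℝ) ≠ 0 := by positivity
    field_simp
    ring
  have hC := (hasSum_nat_add_iff' 1).2 hB
  simp only [Finset.range_one, Finset.sum_singleton, Nat.cast_zero, zero_mul, sub_zero] at hC
  let f : ℕ × ℕ → ℝ := fun z => 1 / (x + ((z.1 : ℝ) + 1) + (z.2 : ℝ)) ^ (q + 1)
  have hf0 : ∀ z, 0 ≤ f z := fun z => by positivity
  let e := Finset.HasAntidiagonal.sigmaAntidiagonalEquivProd (A := ℕ)
  have hfib : ∀ m : ℕ, HasSum (fun c : Finset.HasAntidiagonal.antidiagonal m => (f ∘ e) ⟨m, c⟩)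
      (((m + 1 : ℕ) : ℝ) * (1 / (x + ((m + 1 : ℕ) : ℝ)) ^ (q + 1))) := by
    intro m
    have hc : ∀ c : Finset.HasAntidiagonal.antidiagonal m, (f ∘ e) ⟨m, c⟩ =
        1 / (x + ((m + 1 : ℕ) : ℝ)) ^ (q + 1) := by
      rintro ⟨⟨i, j⟩, hij⟩
      have hij' : i + j = m := Finset.HasAntidiagonal.mem_antidiagonal.1 hij
      subst hij'
      simp only [f, e, Function.comp, Finset.HasAntidiagonal.sigmaAntidiagonalEquivProd_apply]
      push_cast
      ring_nf
    have := hasSum_fintype (fun c : Finset.HasAntidiagonal.antidiagonal m => (f ∘ e) ⟨m, c⟩)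
    rw [Finset.sum_congr rfl (fun c _ => hc c)] at this
    simpa using this
  have hs : Summable (f ∘ e) := by
    exact (summable_sigma_of_nonneg (f := f ∘ e) (fun z => hf0 _)).2 ⟨fun m => (hfib m).summable, hC.summable.congr fun m => (hfib m).tsum_eq.symm⟩
  have hD : HasSum f _ := e.hasSum_iff.1 (HasSum.sigma_of_hasSum hC hfib hs)
  exact hD.prod_fiberwise fun n => (aux_summable (x := x + ((n : ℝ) + 1)) (by positivity)
    (q := q + 1) (by omega)).hasSum

/-- For every integer `p ≥ 2` and real `x > 0`,
`∑_{n=1}^∞ ψ⁽ᵖ⁾(x+n) = −x ψ⁽ᵖ⁾(x) − p ψ⁽ᵖ⁻¹⁾(x)`, the series converging;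
here `ψ⁽ᵖ⁾` is the `p`-th derivative of the digamma function. -/
theorem tsum_polygamma (p : ℕ) (hp : 2 ≤ p) (x : ℝ) (hx : 0 < x) :
    HasSum (fun n : ℕ => iteratedDeriv p digamma (x + ((n : ℝ) + 1)))
      (-x * iteratedDeriv p digamma x - (p : ℝ) * iteratedDeriv (p - 1) digamma x) := by
  obtain ⟨r, rfl⟩ : ∃ r, p = r + 2 := ⟨p - 2, by omega⟩
  have h := (aux_double (q := r + 2) (by omega) hx).mul_left
    ((-1) ^ (r + 1) * ((r + 2).factorial : ℝ))
  have e1 : r + 2 - 1 = r + 1 := rfl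
  rw [e1, iteratedDeriv_digamma r x hx, iteratedDeriv_digamma (r + 1) x hx]
  have hF : (fun n : ℕ => iteratedDeriv (r + 2) digamma (x + ((n : ℝ) + 1))) = fun n : ℕ =>
      (-1) ^ (r + 1) * ((r + 2).factorial : ℝ) *
        ∑' k : ℕ, 1 / (x + ((n : ℝ) + 1) + (k : ℝ)) ^ (r + 2 + 1) := by
    funext n
    exact iteratedDeriv_digamma (r + 1) _ (by positivity)
  have hV : ∀ A B : ℝ, -x * ((-1) ^ (r + 1) * ((r + 1 + 1).factorial : ℝ) * A) -
      ((r + 2 : ℕ) : ℝ) * ((-1) ^ r * ((r + 1).factorial : ℝ) * B) =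
      (-1) ^ (r + 1) * ((r + 2).factorial : ℝ) * (B - x * A) := by
    intro A B
    rw [Nat.factorial_succ (r + 1)]
    push_cast
    ring
  rw [hF, hV]
  exact h
end
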